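/- arXiv:1608.01732 — 2 statements merged into one kernel-verified Lean document; each statement's English description precedes it below -/
import Mathlib

section
/- Let r ≥ 1 and m ≥ 1 be integers and let S̃ be a subset of the index set {1,…,m} with |S̃| < m. Then the number of vectors a = (a_1,…,a_m) ∈ (ℤ/rℤ)^m such that either a_i = 0 for some i ∈ S̃, or a_1 + a_2 + ⋯ + a_m = 0 in ℤ/rℤ, equals r^m − (r−1)^{|S̃|+1}·r^{m−1−|S̃|}. -/
/-- Replacing the coordinate `j` of a vector by the sum of all its coordinates is a bijection. -/
def Equiv.updateSum {ι G : Type*} [Fintype ι] [DecidableEq ι] [AddCommGroup G] (j : ι) :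
    (ι → G) ≃ (ι → G) where
  toFun a := Function.update a j (∑ i, a i)
  invFun b := Function.update b j (b j - ∑ i ∈ Finset.univ.erase j, b i)
  left_inv a := by
    have h : ∑ i ∈ Finset.univ.erase j, Function.update a j (∑ i, a i) i =
        ∑ i ∈ Finset.univ.erase j, a i :=
      Finset.sum_congr rfl fun i hi => Function.update_of_ne (Finset.ne_of_mem_erase hi) _ _
    beta_reduce
    rw [h, Function.update_self, Function.update_idem,
      ← Finset.add_sum_erase _ _ (Finset.mem_univ j), add_sub_cancel_right, Function.update_eq_self]
  right_inv b := by
    beta_reduce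
    rw [Finset.sum_update_of_mem (Finset.mem_univ j), ← Finset.erase_eq, sub_add_cancel,
      Function.update_idem, Function.update_eq_self]

/-- The number of vectors that are nonzero at every coordinate in `T`. -/
theorem card_forall_mem_ne_zero {ι G : Type*} [Fintype ι] [Fintype G] [Zero G] (T : Finset ι) :
    Nat.card {b : ι → G // ∀ i ∈ T, b i ≠ 0} =
      (Fintype.card G - 1) ^ T.card * Fintype.card G ^ (Fintype.card ι - T.card) := by
  classical
  have h : {b : ι → G | ∀ i ∈ T, b i ≠ 0} =
      (Fintype.piFinset fun i => if i ∈ T then {(0 : G)}ᶜ else Finset.univ : Finset (ι → G)) := by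
    ext b
    simp only [Set.mem_ofPred_eq, Finset.mem_coe, Fintype.mem_piFinset]
    refine forall_congr' fun i => ?_
    by_cases hi : i ∈ T <;> simp [hi]
  change Nat.card ({b : ι → G | ∀ i ∈ T, b i ≠ 0} : Set (ι → G)) = _
  rw [h, Nat.card_eq_card_toFinset, Finset.toFinset_coe, Fintype.card_piFinset]
  simp only [apply_ite Finset.card, Finset.card_compl, Finset.card_singleton, Finset.card_univ]
  rw [Finset.prod_ite]
  simp [← Finset.compl_filter, Finset.card_compl]

/-- The number of vectors that are nonzero at every coordinate in `S` and have nonzero sum. -/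
theorem card_forall_mem_ne_zero_and_sum_ne_zero {ι G : Type*} [Fintype ι] [Fintype G]
    [AddCommGroup G] (S : Finset ι) (hS : S.card < Fintype.card ι) :
    Nat.card {a : ι → G // (∀ i ∈ S, a i ≠ 0) ∧ ∑ i, a i ≠ 0} =
      (Fintype.card G - 1) ^ (S.card + 1) * Fintype.card G ^ (Fintype.card ι - 1 - S.card) := by
  classical
  obtain ⟨j, hj⟩ : ∃ j, j ∉ S := by
    by_contra! h
    rw [Finset.eq_univ_of_forall h, Finset.card_univ] at hS
    exact hS.false
  rw [Nat.sub_sub, Nat.add_comm 1, ← Finset.card_insert_of_notMem hj, ← card_forall_mem_ne_zero]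
  refine Nat.card_congr ((Equiv.updateSum j).subtypeEquiv fun a => ?_)
  have h : ∀ i ∈ S, Function.update a j (∑ i, a i) i = a i := fun i hi =>
    Function.update_of_ne (ne_of_mem_of_not_mem hi hj) _ _
  simp +contextual [Equiv.updateSum, h, and_comm]


/-- Let `r ≥ 1` and `m ≥ 1` be integers and let `S̃` be a subset of the index set `{1,…,m}`
with `|S̃| < m`. Then the number of vectors `a ∈ (ℤ/rℤ)^m` such that either `a i = 0` for some
`i ∈ S̃`, or `a 1 + ⋯ + a m = 0` in `ℤ/rℤ`, equals `r^m − (r−1)^(|S̃|+1) * r^(m−1−|S̃|)`. -/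
theorem stmt_2 (r m : ℕ) (hr : 1 ≤ r) (hm : 1 ≤ m) (S : Finset (Fin m)) (hS : S.card < m) :
    Nat.card {a : Fin m → ZMod r // (∃ i ∈ S, a i = 0) ∨ (∑ i, a i = 0)} =
      r ^ m - (r - 1) ^ (S.card + 1) * r ^ (m - 1 - S.card) := by
  have : NeZero r := ⟨by omega⟩
  have h := card_forall_mem_ne_zero_and_sum_ne_zero (G := ZMod r) S (by simpa using hS)
  simp only [ZMod.card, Fintype.card_fin] at h
  have hc := Nat.card_congr
    (Equiv.sumCompl fun a : Fin m → ZMod r => (∃ i ∈ S, a i = 0) ∨ ∑ i, a i = 0)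
  simp only [Nat.card_sum, not_or, not_exists, not_and, Nat.card_fun, Nat.card_zmod,
    Nat.card_fin] at hc
  simp only [ne_eq] at h
  omega
end

section
/- Let (Ω, μ) be a probability space and let S : Ω → 𝒮 and R : Ω → ℛ be measurable random variables taking values in finite types (with the discrete measurable structure) such that S and R are independent. Let φ : 𝒮 × ℛ → ℰ be a function into a finite type and set E = φ(S, R). If the Shannon entropies satisfy H[E] ≤ H[R] and the conditional entropy satisfies H[R | ⟨S, E⟩] = 0, then the mutual information satisfies I[S : E] = 0. -/
open MeasureTheory ProbabilityTheory

/-- Shannon entropy `H[X]` of a random variable `X : Ω → S` taking values in a finite type,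
with respect to the measure `μ`. -/
noncomputable def shannonEntropy {Ω : Type*} [MeasurableSpace Ω] (μ : Measure Ω)
    {S : Type*} [Fintype S] (X : Ω → S) : ℝ :=
  ∑ s : S, Real.negMulLog ((μ (X ⁻¹' {s})).toReal)

/-- Conditional Shannon entropy `H[X | Y] = H[⟨X, Y⟩] − H[Y]`. -/
noncomputable def shannonCondEntropy {Ω : Type*} [MeasurableSpace Ω] (μ : Measure Ω)
    {S T : Type*} [Fintype S] [Fintype T] (X : Ω → S) (Y : Ω → T) : ℝ :=
  shannonEntropy μ (fun ω => (X ω, Y ω)) - shannonEntropy μ Y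

/-- Mutual information `I[X : Y] = H[X] + H[Y] − H[⟨X, Y⟩]`. -/
noncomputable def shannonMutualInfo {Ω : Type*} [MeasurableSpace Ω] (μ : Measure Ω)
    {S T : Type*} [Fintype S] [Fintype T] (X : Ω → S) (Y : Ω → T) : ℝ :=
  shannonEntropy μ X + shannonEntropy μ Y - shannonEntropy μ (fun ω => (X ω, Y ω))

/-- Shannon entropy is invariant under relabelling the values by an injective map. -/
theorem shannonEntropy_comp_injective {Ω S T : Type*} [MeasurableSpace Ω] [Fintype S] [Fintype T]
    (μ : Measure Ω) (X : Ω → S) {f : S → T} (hf : Function.Injective f) :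
    shannonEntropy μ (fun ω => f (X ω)) = shannonEntropy μ X := by
  unfold shannonEntropy
  refine (Fintype.sum_of_injective f hf _ _ (fun t ht => ?_) (fun s => ?_)).symm
  · have : (fun ω => f (X ω)) ⁻¹' {t} = ∅ := by
      ext ω
      simp only [Set.mem_preimage, Set.mem_singleton_iff, Set.mem_empty_iff_false, iff_false]
      exact fun h => ht ⟨X ω, h⟩
    simp [this]
  · have : (fun ω => f (X ω)) ⁻¹' {f s} = X ⁻¹' {s} := by
      ext ω
      simp [hf.eq_iff]
    rw [this]

theorem shannonEntropy_prodMk {Ω S T : Type*} [MeasurableSpace Ω] [Fintype S] [Fintype T]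
    (μ : Measure Ω) (X : Ω → S) (Y : Ω → T) :
    shannonEntropy μ (fun ω => (X ω, Y ω)) =
      ∑ s : S, ∑ t : T, Real.negMulLog ((μ (X ⁻¹' {s} ∩ Y ⁻¹' {t})).toReal) := by
  unfold shannonEntropy
  rw [Fintype.sum_prod_type]
  refine Finset.sum_congr rfl fun s _ => Finset.sum_congr rfl fun t _ => ?_
  have : (fun ω => (X ω, Y ω)) ⁻¹' {(s, t)} = X ⁻¹' {s} ∩ Y ⁻¹' {t} := by
    ext ω
    simp
  rw [this]

section JointLaw

variable {Ω S T : Type*} [MeasurableSpace Ω]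
  [MeasurableSpace S] [DiscreteMeasurableSpace S] [Fintype S]
  [MeasurableSpace T] [DiscreteMeasurableSpace T] [Fintype T]
  {μ : Measure Ω} {X : Ω → S} {Y : Ω → T}

theorem sum_toReal_measure_preimage_singleton [IsProbabilityMeasure μ] (hX : Measurable X) :
    ∑ s : S, (μ (X ⁻¹' {s})).toReal = 1 := by
  rw [← ENNReal.toReal_sum fun _ _ => measure_ne_top _ _,
    sum_measure_preimage_singleton _ fun s _ => hX (measurableSet_singleton s)]
  simp

theorem sum_toReal_measure_inter_preimage_singleton [IsFiniteMeasure μ] (hY : Measurable Y)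
    (A : Set Ω) : ∑ t : T, (μ (A ∩ Y ⁻¹' {t})).toReal = (μ A).toReal := by
  rw [← ENNReal.toReal_sum fun _ _ => measure_ne_top _ _]
  have h := sum_measure_preimage_singleton (μ := μ.restrict A) (f := Y) Finset.univ
    fun t _ => hY (measurableSet_singleton t)
  simp only [Finset.coe_univ, Set.preimage_univ, Measure.restrict_apply_univ] at h
  rw [← h]
  congr 1
  refine Finset.sum_congr rfl fun t _ => ?_
  rw [Measure.restrict_apply (hY (measurableSet_singleton t)), Set.inter_comm]

/-- The joint entropy of independent random variables is the sum of their entropies. -/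
theorem ProbabilityTheory.IndepFun.shannonEntropy_prodMk [IsProbabilityMeasure μ]
    (hXY : IndepFun X Y μ) (hX : Measurable X) (hY : Measurable Y) :
    shannonEntropy μ (fun ω => (X ω, Y ω)) = shannonEntropy μ X + shannonEntropy μ Y := by
  rw [_root_.shannonEntropy_prodMk]
  simp_rw [hXY.measure_inter_preimage_eq_mul _ _ (measurableSet_singleton _)
    (measurableSet_singleton _), ENNReal.toReal_mul, Real.negMulLog_mul, Finset.sum_add_distrib,
    ← Finset.sum_mul, ← Finset.mul_sum, ← Finset.sum_mul]
  rw [sum_toReal_measure_preimage_singleton hX, sum_toReal_measure_preimage_singleton hY]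
  simp [shannonEntropy]

theorem Real.negMulLog_le_of_le {p a b : ℝ} (hp : 0 ≤ p) (ha : p ≤ a) (hb : p ≤ b) :
    Real.negMulLog p ≤ -(p * Real.log a) - p * Real.log b + (a * b - p) := by
  rcases hp.eq_or_lt with rfl | hp
  · simpa using mul_nonneg ha hb
  have ha' : 0 < a := hp.trans_le ha
  have hb' : 0 < b := hp.trans_le hb
  have h := Real.log_le_sub_one_of_pos (div_pos (mul_pos ha' hb') hp)
  rw [Real.log_div (mul_pos ha' hb').ne' hp.ne', Real.log_mul ha'.ne' hb'.ne'] at h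
  have h2 := mul_le_mul_of_nonneg_left h hp.le
  have h3 : p * (a * b / p - 1) = a * b - p := by field_simp
  rw [Real.negMulLog]
  linarith

/-- Subadditivity of Shannon entropy. -/
theorem shannonEntropy_prodMk_le [IsProbabilityMeasure μ] (hX : Measurable X)
    (hY : Measurable Y) :
    shannonEntropy μ (fun ω => (X ω, Y ω)) ≤ shannonEntropy μ X + shannonEntropy μ Y := by
  have hrow (s : S) := sum_toReal_measure_inter_preimage_singleton (μ := μ) hY (X ⁻¹' {s})
  have hcol (t : T) : ∑ s : S, (μ (X ⁻¹' {s} ∩ Y ⁻¹' {t})).toReal = (μ (Y ⁻¹' {t})).toReal := by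
    simp_rw [Set.inter_comm _ (Y ⁻¹' {t})]
    exact sum_toReal_measure_inter_preimage_singleton hX _
  rw [shannonEntropy_prodMk]
  calc
    _ ≤ ∑ s : S, ∑ t : T,
        (-((μ (X ⁻¹' {s} ∩ Y ⁻¹' {t})).toReal * Real.log (μ (X ⁻¹' {s})).toReal)
          - (μ (X ⁻¹' {s} ∩ Y ⁻¹' {t})).toReal * Real.log (μ (Y ⁻¹' {t})).toReal
          + ((μ (X ⁻¹' {s})).toReal * (μ (Y ⁻¹' {t})).toReal
            - (μ (X ⁻¹' {s} ∩ Y ⁻¹' {t})).toReal)) := by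
      refine Finset.sum_le_sum fun s _ => Finset.sum_le_sum fun t _ => ?_
      exact Real.negMulLog_le_of_le ENNReal.toReal_nonneg
        (ENNReal.toReal_mono (measure_ne_top _ _) (measure_mono Set.inter_subset_left))
        (ENNReal.toReal_mono (measure_ne_top _ _) (measure_mono Set.inter_subset_right))
    _ = shannonEntropy μ X + shannonEntropy μ Y := by
      simp_rw [Finset.sum_add_distrib, Finset.sum_sub_distrib, Finset.sum_neg_distrib,
        ← Finset.mul_sum, ← Finset.sum_mul, hrow]
      rw [Finset.sum_comm (f := fun s t => (μ (X ⁻¹' {s} ∩ Y ⁻¹' {t})).toReal *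
        Real.log (μ (Y ⁻¹' {t})).toReal)]
      simp_rw [← Finset.sum_mul, hcol]
      rw [sum_toReal_measure_preimage_singleton hX, sum_toReal_measure_preimage_singleton hY]
      simp only [shannonEntropy, Real.negMulLog, neg_mul, Finset.sum_neg_distrib]
      ring

end JointLaw

/-- **Secrecy Lemma.** Let `S` and `R` be independent finite-valued random variables on a
probability space `(Ω, μ)`, and let `E = φ (S, R)` for a function `φ` into a finite type.
If `H[E] ≤ H[R]` and `H[R | ⟨S, E⟩] = 0`, then `I[S : E] = 0`. -/
theorem stmt_5 {Ω 𝒮 ℛ ℰ : Type*} [MeasurableSpace Ω]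
    [MeasurableSpace 𝒮] [DiscreteMeasurableSpace 𝒮] [Fintype 𝒮]
    [MeasurableSpace ℛ] [DiscreteMeasurableSpace ℛ] [Fintype ℛ]
    [MeasurableSpace ℰ] [DiscreteMeasurableSpace ℰ] [Fintype ℰ]
    (μ : Measure Ω) [IsProbabilityMeasure μ]
    (S : Ω → 𝒮) (R : Ω → ℛ) (hS : Measurable S) (hR : Measurable R)
    (hSR : IndepFun S R μ) (φ : 𝒮 × ℛ → ℰ)
    (hHE : shannonEntropy μ (fun ω => φ (S ω, R ω)) ≤ shannonEntropy μ R)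
    (hcond : shannonCondEntropy μ R (fun ω => (S ω, φ (S ω, R ω))) = 0) :
    shannonMutualInfo μ S (fun ω => φ (S ω, R ω)) = 0 := by
  have hE : Measurable fun ω => φ (S ω, R ω) :=
    (Measurable.of_discrete (f := φ)).comp (hS.prodMk hR)
  have hsub := shannonEntropy_prodMk_le (μ := μ) hS hE
  have hadd := hSR.shannonEntropy_prodMk hS hR
  have hinj : Function.Injective fun p : 𝒮 × ℛ => (p.2, p.1, φ p) := by
    rintro ⟨s, r⟩ ⟨s', r'⟩ h
    simp only [Prod.mk.injEq] at h ⊢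
    exact ⟨h.2.1, h.1⟩
  have hjoint := shannonEntropy_comp_injective μ (fun ω => (S ω, R ω)) hinj
  simp only [shannonCondEntropy] at hcond
  unfold shannonMutualInfo
  linarith
end
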